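/- Let 1 < p < n, 0 ≤ s ≤ p, and set q = p(n−s)/(n−p). Let C > 0 be a constant such that the Euclidean Hardy–Sobolev inequality C (∫_{ℝⁿ} |φ(x)|^q / |x|^s dx)^{(n−p)/(n−s)} ≤ ∫_{ℝⁿ} |∇φ(x)|ᵖ dx holds for every Lipschitz function φ : ℝⁿ → ℝ with compact support. Let u : M → ℝ be a bounded measurable function with bounded support whose Euclidean rearrangement u* is Lipschitz with compact support. Then C (∫_M |u(q')|^q / d(o,q')^s dμ(q'))^{(n−p)/(n−s)} ≤ ∫_{ℝⁿ} |∇u*(x)|ᵖ dx. -/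

import Mathlib

open MeasureTheory

/-- Layer-cake formula for the integral of a product of two nonnegative functions. -/
theorem lintegral_ofReal_mul_eq_lintegral_meas_inter {γ : Type*} [MeasurableSpace γ]
    (κ : Measure γ) {f g : γ → ℝ} (hf : Measurable f) (hg : Measurable g)
    (hf0 : 0 ≤ f) (hg0 : 0 ≤ g) :
    ∫⁻ x, ENNReal.ofReal (f x * g x) ∂κ = ∫⁻ a in Set.Ioi 0, ∫⁻ b in Set.Ioi 0,
      κ ({x | b < g x} ∩ {x | a < f x}) := by
  have hfg : ∫⁻ x, ENNReal.ofReal (f x * g x) ∂κ =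
      ∫⁻ x, ENNReal.ofReal (f x) ∂(κ.withDensity fun x => ENNReal.ofReal (g x)) := by
    rw [lintegral_withDensity_eq_lintegral_mul _ hg.ennreal_ofReal hf.ennreal_ofReal]
    refine lintegral_congr fun x => ?_
    rw [Pi.mul_apply, ENNReal.ofReal_mul (hf0 x), mul_comm]
  rw [hfg, lintegral_eq_lintegral_meas_lt _ (.of_forall hf0) hf.aemeasurable]
  refine lintegral_congr fun a => ?_
  rw [withDensity_apply _ (measurableSet_lt measurable_const hf),
    lintegral_eq_lintegral_meas_lt _ (.of_forall hg0) hg.aemeasurable]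
  refine lintegral_congr fun b => ?_
  rw [Measure.restrict_apply (measurableSet_lt measurable_const hg)]

/-- Comparison of integrals of products through the joint superlevel sets of the factors. -/
theorem lintegral_ofReal_mul_le_of_meas_inter_le {α β : Type*} [MeasurableSpace α]
    [MeasurableSpace β] {μ : Measure α} {ν : Measure β} {f g : α → ℝ} {F G : β → ℝ}
    (hf : Measurable f) (hg : Measurable g) (hF : Measurable F) (hG : Measurable G)
    (hf0 : 0 ≤ f) (hg0 : 0 ≤ g) (hF0 : 0 ≤ F) (hG0 : 0 ≤ G)
    (h : ∀ a > 0, ∀ b > 0, μ ({x | b < g x} ∩ {x | a < f x}) ≤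
      ν ({y | b < G y} ∩ {y | a < F y})) :
    ∫⁻ x, ENNReal.ofReal (f x * g x) ∂μ ≤ ∫⁻ y, ENNReal.ofReal (F y * G y) ∂ν := by
  rw [lintegral_ofReal_mul_eq_lintegral_meas_inter μ hf hg hf0 hg0,
    lintegral_ofReal_mul_eq_lintegral_meas_inter ν hF hG hF0 hG0]
  exact setLIntegral_mono' measurableSet_Ioi fun a ha =>
    setLIntegral_mono' measurableSet_Ioi fun b hb => h a ha b hb

theorem lt_inv_rpow_iff {b d s : ℝ} (hb : 0 < b) (hs : 0 < s) (hd : 0 ≤ d) :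
    b < (d ^ s)⁻¹ ↔ d ≠ 0 ∧ d < b⁻¹ ^ s⁻¹ := by
  rcases hd.eq_or_lt with rfl | hd
  · simp [Real.zero_rpow hs.ne', hb.le]
  · rw [lt_inv_comm₀ hb (Real.rpow_pos_of_pos hd s),
      Real.lt_rpow_inv_iff_of_pos hd.le (inv_nonneg.2 hb.le) hs]
    simp [hd.ne']

/-- A centred ball meets a superlevel set of a radially nonincreasing function in a set of
measure the minimum of the two measures. -/
theorem min_measure_le_measure_ball_inter {E : Type*} [NormedAddCommGroup E]
    [MeasurableSpace E] (ν : Measure E) {v : E → ℝ} (hv : ∀ x y, ‖x‖ ≤ ‖y‖ → v y ≤ v x)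
    (ρ t : ℝ) :
    min (ν (Metric.ball 0 ρ)) (ν {x | t < v x}) ≤ ν (Metric.ball 0 ρ ∩ {x | t < v x}) := by
  by_cases hsub : {x | t < v x} ⊆ Metric.ball (0 : E) ρ
  · rw [Set.inter_eq_right.2 hsub]
    exact min_le_right _ _
  · obtain ⟨x, hx, hxρ⟩ := Set.not_subset.1 hsub
    have hball : Metric.ball (0 : E) ρ ⊆ {x | t < v x} := fun y hy =>
      lt_of_lt_of_le hx (hv y x (by simp at hy hxρ; linarith))
    rw [Set.inter_eq_left.2 hball]
    exact min_le_left _ _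

/-- Hardy–Littlewood type inequality for the singular weight `d(o,·)^{-s}` under the
Bishop–Gromov volume bound. -/
theorem lintegral_rpow_div_dist_rpow_le {n : ℕ} (hn : n ≠ 0)
    {M : Type*} [MetricSpace M] [MeasurableSpace M] [BorelSpace M] {μ : Measure M} {o : M}
    (hBG : ∀ ρ > (0 : ℝ), μ (Metric.ball o ρ) ≤
      volume (Metric.ball (0 : EuclideanSpace ℝ (Fin n)) 1) * ENNReal.ofReal (ρ ^ n))
    {q s : ℝ} (hq : 0 < q) (hs : 0 ≤ s) {u : M → ℝ} (hu : Measurable u)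
    {v : EuclideanSpace ℝ (Fin n) → ℝ} (hv : Measurable v) (hv0 : ∀ x, 0 ≤ v x)
    (hv_mono : ∀ x y, ‖x‖ ≤ ‖y‖ → v y ≤ v x)
    (h_level : ∀ t > (0 : ℝ), volume {x | t < v x} = μ {z | t < |u z|}) :
    ∫⁻ z, ENNReal.ofReal (|u z| ^ q / dist o z ^ s) ∂μ ≤
      ∫⁻ x, ENNReal.ofReal (|v x| ^ q / ‖x‖ ^ s) := by
  have : Nonempty (Fin n) := ⟨⟨0, Nat.pos_of_ne_zero hn⟩⟩
  have hdist : Measurable fun z => dist o z := (continuous_const.dist continuous_id).measurable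
  have habs : Measurable fun z => |u z| := by simpa only [Real.norm_eq_abs] using hu.norm
  have hvabs : ∀ x, |v x| = v x := fun x => abs_of_nonneg (hv0 x)
  simp only [div_eq_mul_inv, hvabs]
  refine lintegral_ofReal_mul_le_of_meas_inter_le (habs.pow_const q) (hdist.pow_const s).inv
    (hv.pow_const q) (measurable_norm.pow_const s).inv
    (fun z => Real.rpow_nonneg (abs_nonneg _) _)
    (fun z => inv_nonneg.2 (Real.rpow_nonneg dist_nonneg _))
    (fun x => Real.rpow_nonneg (hv0 x) _)
    (fun x => inv_nonneg.2 (Real.rpow_nonneg (norm_nonneg _) _)) fun a ha b hb => ?_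
  have ha' : 0 < a ^ q⁻¹ := Real.rpow_pos_of_pos ha _
  have hlt : ∀ {y : ℝ}, 0 ≤ y → (a < y ^ q ↔ a ^ q⁻¹ < y) := fun hy =>
    (Real.rpow_inv_lt_iff_of_pos ha.le hy hq).symm
  have hA : {z | a < |u z| ^ q} = {z | a ^ q⁻¹ < |u z|} :=
    Set.ext fun z => hlt (abs_nonneg _)
  have hA' : {x | a < v x ^ q} = {x | a ^ q⁻¹ < v x} := Set.ext fun x => hlt (hv0 x)
  rw [hA, hA']
  rcases hs.eq_or_lt with rfl | hs
  · by_cases hb1 : b < 1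
    · simp [hb1, h_level _ ha']
    · simp [hb1]
  · have hρ : 0 < b⁻¹ ^ s⁻¹ := Real.rpow_pos_of_pos (inv_pos.2 hb) _
    set ρ := b⁻¹ ^ s⁻¹
    have hB : {z | b < (dist o z ^ s)⁻¹} ⊆ Metric.ball o ρ := fun z hz =>
      Metric.mem_ball'.2 ((lt_inv_rpow_iff hb hs dist_nonneg).1 hz).2
    have hB' : {x : EuclideanSpace ℝ (Fin n) | b < (‖x‖ ^ s)⁻¹} = Metric.ball 0 ρ \ {0} := by
      ext x
      simp [lt_inv_rpow_iff hb hs (norm_nonneg x), and_comm, ρ]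
    have hvol : μ (Metric.ball o ρ) ≤ volume (Metric.ball (0 : EuclideanSpace ℝ (Fin n)) ρ) := by
      rw [Measure.addHaar_ball _ _ hρ.le, finrank_euclideanSpace_fin, mul_comm]
      exact hBG ρ hρ
    rw [hB', ← Set.inter_sdiff_right_comm, measure_sdiff_null (measure_singleton _)]
    refine le_trans (le_min ?_ ?_) (min_measure_le_measure_ball_inter volume hv_mono ρ _)
    · exact (measure_mono (Set.inter_subset_left.trans hB)).trans hvol
    · rw [h_level _ ha']
      exact measure_mono Set.inter_subset_right

/-- Hardy–Sobolev step on `M`: if the Euclidean Hardy–Sobolev inequality with constant `C`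
holds for all Lipschitz compactly supported `φ : ℝⁿ → ℝ`, then for a bounded measurable `u`
with bounded support whose Euclidean rearrangement `ustar` is Lipschitz with compact support,
`C (∫_M |u|^q / d(o,·)^s dμ)^{(n−p)/(n−s)} ≤ ∫_{ℝⁿ} |∇u*|ᵖ dx`, where
`q = p(n−s)/(n−p)`, under the Bishop–Gromov bound. -/
theorem hardy_sobolev_via_rearrangement
    {n : ℕ} (hn : 3 ≤ n)
    {M : Type*} [MetricSpace M] [MeasurableSpace M] [BorelSpace M]
    (μ : Measure M) (o : M)
    (hBG : ∀ ρ > (0 : ℝ), μ (Metric.ball o ρ) ≤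
      volume (Metric.ball (0 : EuclideanSpace ℝ (Fin n)) 1) * ENNReal.ofReal (ρ ^ n))
    (p s : ℝ) (hp1 : 1 < p) (hpn : p < n) (hs0 : 0 ≤ s) (hsp : s ≤ p)
    (q : ℝ) (hq : q = p * ((n : ℝ) - s) / ((n : ℝ) - p))
    (C : ℝ) (hC : 0 < C)
    (hHS : ∀ φ : EuclideanSpace ℝ (Fin n) → ℝ,
      (∃ K : NNReal, LipschitzWith K φ) → HasCompactSupport φ →
      ENNReal.ofReal C *
          (∫⁻ x, ENNReal.ofReal (|φ x| ^ q / ‖x‖ ^ s)) ^ (((n : ℝ) - p) / ((n : ℝ) - s))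
        ≤ ∫⁻ x, ENNReal.ofReal (‖fderiv ℝ φ x‖ ^ p))
    (u : M → ℝ) (hu_meas : Measurable u)
    (hu_bdd : ∃ c : ℝ, ∀ q', |u q'| ≤ c)
    (hu_supp : Bornology.IsBounded (Function.support u))
    (ustar : EuclideanSpace ℝ (Fin n) → ℝ)
    (h_nonneg : ∀ x, 0 ≤ ustar x)
    (h_radial : ∀ x y, ‖x‖ = ‖y‖ → ustar x = ustar y)
    (h_mono : ∀ x y, ‖x‖ ≤ ‖y‖ → ustar y ≤ ustar x)
    (h_level : ∀ t > (0 : ℝ),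
      volume {x | t < ustar x} = μ {q' | t < |u q'|})
    (h_lip : ∃ K : NNReal, LipschitzWith K ustar)
    (h_cpt : HasCompactSupport ustar) :
    ENNReal.ofReal C *
        (∫⁻ q', ENNReal.ofReal (|u q'| ^ q / dist o q' ^ s) ∂μ) ^
          (((n : ℝ) - p) / ((n : ℝ) - s))
      ≤ ∫⁻ x, ENNReal.ofReal (‖fderiv ℝ ustar x‖ ^ p) := by
  have hnp : 0 < (n : ℝ) - p := sub_pos.2 hpn
  have hns : 0 < (n : ℝ) - s := by linarith
  have hq0 : 0 < q := by
    rw [hq]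
    exact div_pos (mul_pos (by linarith) hns) hnp
  obtain ⟨K, hK⟩ := h_lip
  refine le_trans ?_ (hHS ustar ⟨K, hK⟩ h_cpt)
  gcongr
  exact lintegral_rpow_div_dist_rpow_le (by omega) hBG hq0 hs0 hu_meas
    hK.continuous.measurable h_nonneg h_mono h_level
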